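/- The sumset L + U₀ equals ℕ \ {F_n − 1 : n ≥ 1 and n even}; that is, a natural number m fails to be expressible as m = a + b with a ∈ L and b ∈ U₀ if and only if m = F_n − 1 for some even integer n ≥ 2. -/

import Mathlib

noncomputable def phi : ℝ := (1 + Real.sqrt 5) / 2

/-- The lower Wythoff set `L = {⌊i·φ⌋ : i ≥ 1}`. -/
def lowerWythoff : Set ℕ := {n | ∃ i : ℕ, 1 ≤ i ∧ n = ⌊(i : ℝ) * phi⌋₊}

/-- The upper Wythoff set `U = {⌊i·φ²⌋ : i ≥ 1}`. -/
def upperWythoff : Set ℕ := {n | ∃ i : ℕ, 1 ≤ i ∧ n = ⌊(i : ℝ) * phi ^ 2⌋₊}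

lemma phi_eq_goldenRatio : phi = Real.goldenRatio := rfl

lemma phi_sq : phi ^ 2 = phi + 1 := Real.goldenRatio_sq

lemma three_halves_lt_phi : 3 / 2 < phi := by
  have h := phi_sq
  have h1 : 1 < phi := Real.one_lt_goldenRatio
  nlinarith

lemma phi_lt_two : phi < 2 := Real.goldenRatio_lt_two

lemma natCast_mul_phi_ne_intCast {n : ℕ} (hn : 1 ≤ n) (z : ℤ) : (n : ℝ) * phi ≠ z := by
  have h : Irrational (n * Real.goldenRatio) :=
    Real.goldenRatio_irrational.natCast_mul (by omega)
  exact h.ne_int z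

lemma fract_eq_of_sub_eq_intCast {x y : ℝ} (z : ℤ) (h0 : 0 ≤ y) (h1 : y < 1) (h : x - y = z) :
    Int.fract x = y :=
  Int.fract_eq_iff.2 ⟨h0, h1, z, h⟩

/-- The multiples of `phi` that witness membership in the Wythoff sets never sit on the
boundary between them. -/
lemma fract_natCast_mul_phi_ne (n : ℕ) : Int.fract ((n : ℝ) * phi) ≠ 2 - phi := by
  intro h
  apply natCast_mul_phi_ne_intCast (Nat.succ_le_succ n.zero_le) (⌊(n : ℝ) * phi⌋ + 2)
  rw [Int.fract] at h
  push_cast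
  linarith

lemma mem_lowerWythoff_iff (n : ℕ) :
    n ∈ lowerWythoff ↔ 2 - phi < Int.fract ((n : ℝ) * phi) := by
  have h32 := three_halves_lt_phi
  have h2 := phi_lt_two
  have hsq := phi_sq
  constructor
  · rintro ⟨i, hi, hn⟩
    have hi0 : (0 : ℝ) ≤ i * phi := by positivity
    obtain ⟨hl, hr⟩ := (Nat.floor_eq_iff hi0).1 hn.symm
    have hne : (n : ℝ) ≠ i * phi := fun h ↦ natCast_mul_phi_ne_intCast hi n (by simpa using h.symm)
    have hl' : (n : ℝ) < i * phi := lt_of_le_of_ne hl hne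
    have hfl : Int.fract ((n : ℝ) * phi) = n * phi - (i + n - 1) := by
      apply fract_eq_of_sub_eq_intCast ((i : ℤ) + n - 1)
      · nlinarith
      · nlinarith
      · push_cast; ring
    rw [hfl]
    nlinarith
  · intro h
    have hlt := Int.fract_lt_one ((n : ℝ) * phi)
    rw [Int.fract] at h hlt
    have hz : (n : ℤ) ≤ ⌊(n : ℝ) * phi⌋ := by
      rw [Int.le_floor]
      push_cast
      nlinarith [(Nat.cast_nonneg n : (0 : ℝ) ≤ n)]
    obtain ⟨i, hi⟩ := Int.eq_ofNat_of_zero_le (sub_nonneg.2 hz)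
    have hfl : (⌊(n : ℝ) * phi⌋ : ℝ) = n + i := by
      have : ⌊(n : ℝ) * phi⌋ = n + i := by omega
      exact_mod_cast this
    rw [hfl] at h hlt
    refine ⟨i + 1, by omega, ((Nat.floor_eq_iff (by positivity)).2 ⟨?_, ?_⟩).symm⟩
    · push_cast; nlinarith
    · push_cast; nlinarith

lemma mem_upperWythoff_union_zero_iff (n : ℕ) :
    n ∈ upperWythoff ∪ {0} ↔ Int.fract ((n : ℝ) * phi) < 2 - phi := by
  have h32 := three_halves_lt_phi
  have h2 := phi_lt_two
  have hsq := phi_sq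
  constructor
  · rintro (⟨i, hi, hn⟩ | hn)
    · have hi0 : (0 : ℝ) ≤ i * phi ^ 2 := by positivity
      obtain ⟨hl, hr⟩ := (Nat.floor_eq_iff hi0).1 hn.symm
      rw [hsq] at hl hr
      have hfl : Int.fract ((n : ℝ) * phi) = n * phi - (2 * n - i) := by
        apply fract_eq_of_sub_eq_intCast (2 * (n : ℤ) - i)
        · nlinarith
        · nlinarith
        · push_cast; ring
      rw [hfl]
      nlinarith
    · rw [Set.mem_singleton_iff] at hn
      subst hn
      simpa using h2
  · intro h
    rcases Nat.eq_zero_or_pos n with hn | hn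
    · exact Or.inr hn
    left
    have hn' : (1 : ℝ) ≤ n := by exact_mod_cast hn
    have h0 := Int.fract_nonneg ((n : ℝ) * phi)
    rw [Int.fract] at h h0
    have hz : ⌊(n : ℝ) * phi⌋ < 2 * (n : ℤ) := by
      rw [Int.floor_lt]
      push_cast
      nlinarith
    obtain ⟨i, hi⟩ := Int.eq_ofNat_of_zero_le (sub_nonneg.2 hz.le)
    have hfl : (⌊(n : ℝ) * phi⌋ : ℝ) = 2 * n - i := by
      have : ⌊(n : ℝ) * phi⌋ = 2 * n - i := by omega
      exact_mod_cast this
    rw [hfl] at h h0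
    refine ⟨i, by omega, ((Nat.floor_eq_iff (by positivity)).2 ⟨?_, ?_⟩).symm⟩
    · rw [hsq]; nlinarith
    · rw [hsq]; nlinarith

/-- `m` avoids `L + U₀` exactly when `m + 1` is a strict record of the fractional parts of the
multiples of `phi`. -/
lemma not_mem_lower_add_upper0_iff_record (m : ℕ) :
    (¬∃ a ∈ lowerWythoff, ∃ b ∈ upperWythoff ∪ {0}, m = a + b) ↔
      ∀ a : ℕ, 1 ≤ a → a ≤ m →
        Int.fract ((a : ℝ) * phi) < Int.fract (((m + 1 : ℕ) : ℝ) * phi) := by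
  have h32 := three_halves_lt_phi
  have h2 := phi_lt_two
  simp only [mem_lowerWythoff_iff, mem_upperWythoff_union_zero_iff]
  constructor
  · intro h
    by_contra! hrec
    obtain ⟨a, ha, ham, hle⟩ := hrec
    apply h
    rcases (fract_natCast_mul_phi_ne m).lt_or_gt with hm | hm
    · have hm0 := Int.fract_nonneg ((m : ℝ) * phi)
      have ha1 := Int.fract_lt_one ((a : ℝ) * phi)
      have hsucc : Int.fract (((m + 1 : ℕ) : ℝ) * phi) = Int.fract ((m : ℝ) * phi) + phi - 1 := by
        apply fract_eq_of_sub_eq_intCast (⌊(m : ℝ) * phi⌋ + 1)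
        · linarith
        · linarith
        · rw [Int.fract]; push_cast; ring
      rw [hsucc] at hle
      have hb : Int.fract (((m - a : ℕ) : ℝ) * phi)
          = Int.fract ((m : ℝ) * phi) - Int.fract ((a : ℝ) * phi) + 1 := by
        apply fract_eq_of_sub_eq_intCast (⌊(m : ℝ) * phi⌋ - ⌊(a : ℝ) * phi⌋ - 1)
        · linarith
        · linarith
        · rw [Int.fract, Int.fract]; push_cast [ham]; ring
      refine ⟨a, by linarith, m - a, lt_of_le_of_ne ?_ (fract_natCast_mul_phi_ne _), by omega⟩
      rw [hb]
      linarith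
    · exact ⟨m, hm, 0, by simpa using h2, rfl⟩
  · rintro h ⟨a, ha, b, hb, rfl⟩
    have ha1 := Int.fract_lt_one ((a : ℝ) * phi)
    have hb0 := Int.fract_nonneg ((b : ℝ) * phi)
    have hapos : 1 ≤ a := by
      rcases Nat.eq_zero_or_pos a with rfl | h'
      · norm_num at ha
        linarith
      · exact h'
    have hrec := h a hapos (by omega)
    have hsum : Int.fract (((a + b + 1 : ℕ) : ℝ) * phi)
        = Int.fract ((a : ℝ) * phi) + Int.fract ((b : ℝ) * phi) + phi - 2 := by
      apply fract_eq_of_sub_eq_intCast (⌊(a : ℝ) * phi⌋ + ⌊(b : ℝ) * phi⌋ + 2)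
      · linarith
      · linarith
      · rw [Int.fract, Int.fract]; push_cast; ring
    linarith

lemma goldenConj_pow_even_pos (j : ℕ) : 0 < Real.goldenConj ^ (2 * j + 2) :=
  Even.pow_pos ⟨j + 1, by ring⟩ Real.goldenConj_ne_zero

lemma fract_fib_even_mul_phi (j : ℕ) :
    Int.fract ((Nat.fib (2 * j + 2) : ℝ) * phi) = 1 - Real.goldenConj ^ (2 * j + 2) := by
  have h := Real.fib_succ_sub_goldenRatio_mul_fib (2 * j + 2)
  rw [← phi_eq_goldenRatio] at h
  apply fract_eq_of_sub_eq_intCast ((Nat.fib (2 * j + 2 + 1) : ℤ) - 1)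
  · have : Real.goldenConj ^ (2 * j + 2) ≤ 1 := by
      rw [show 2 * j + 2 = 2 * (j + 1) by ring, pow_mul]
      apply pow_le_one₀ (sq_nonneg _)
      nlinarith [Real.neg_one_lt_goldenConj, Real.goldenConj_neg]
    linarith
  · linarith [goldenConj_pow_even_pos j]
  · push_cast
    linarith

lemma fib_even_cassini (j : ℕ) :
    (Nat.fib (2 * j + 3) : ℤ) ^ 2
      - Nat.fib (2 * j + 2) * (Nat.fib (2 * j + 2) + Nat.fib (2 * j + 3)) = 1 := by
  induction j with
  | zero => norm_num [Nat.fib_add_two]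
  | succ j ih =>
    have h4 : Nat.fib (2 * (j + 1) + 2) = Nat.fib (2 * j + 2) + Nat.fib (2 * j + 3) :=
      Nat.fib_add_two
    have h5 : Nat.fib (2 * (j + 1) + 3) = Nat.fib (2 * j + 3) + Nat.fib (2 * (j + 1) + 2) :=
      Nat.fib_add_two
    rw [h5, h4]
    push_cast
    linarith

/-- Best approximation from above: below the next even-indexed Fibonacci number, only
`fib (2 * j + 2)` gets as close to an integer from below. -/
lemma eq_fib_of_le_fract {j a : ℕ} (ha : 1 ≤ a) (hlt : a < Nat.fib (2 * j + 4))
    (h : 1 - Real.goldenConj ^ (2 * j + 2) ≤ Int.fract ((a : ℝ) * phi)) :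
    a = Nat.fib (2 * j + 2) := by
  have hpos := goldenConj_pow_even_pos j
  have hψ0 := Real.goldenConj_neg
  have hψ1 := Real.neg_one_lt_goldenConj
  have hcas := fib_even_cassini j
  have h4 : Nat.fib (2 * j + 4) = Nat.fib (2 * j + 2) + Nat.fib (2 * j + 3) := Nat.fib_add_two
  have e1 := Real.fib_succ_sub_goldenRatio_mul_fib (2 * j + 2)
  have e2 := Real.fib_succ_sub_goldenRatio_mul_fib (2 * j + 3)
  rw [← phi_eq_goldenRatio] at e1 e2
  rw [show 2 * j + 2 + 1 = 2 * j + 3 by ring] at e1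
  rw [show 2 * j + 3 + 1 = 2 * j + 4 by ring, h4,
    show Real.goldenConj ^ (2 * j + 3) = Real.goldenConj ^ (2 * j + 2) * Real.goldenConj
      from pow_succ _ _] at e2
  push_cast at e2
  have hx : 0 < Nat.fib (2 * j + 2) := Nat.fib_pos.2 (by omega)
  have hy : 0 < Nat.fib (2 * j + 3) := Nat.fib_pos.2 (by omega)
  have hs1 := Int.fract_lt_one ((a : ℝ) * phi)
  rw [Int.fract] at h hs1
  rw [h4] at hlt
  generalize Real.goldenConj ^ (2 * j + 2) = ε at *
  generalize Nat.fib (2 * j + 2) = x at *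
  generalize Nat.fib (2 * j + 3) = y at *
  generalize Real.goldenConj = ψ at *
  obtain ⟨p, hp⟩ : ∃ p : ℤ, p = ⌊(a : ℝ) * phi⌋ + 1 := ⟨_, rfl⟩
  have hp' : (⌊(a : ℝ) * phi⌋ : ℝ) = p - 1 := by rw [hp]; push_cast; ring
  rw [hp'] at h hs1
  -- coordinates of `(a, p)` in the unimodular basis of consecutive Fibonacci pairs
  obtain ⟨u, hu⟩ : ∃ u : ℤ, u = p * y - a * (x + y) := ⟨_, rfl⟩
  obtain ⟨v, hv⟩ : ∃ v : ℤ, v = a * y - p * x := ⟨_, rfl⟩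
  have hauv : (a : ℤ) = u * x + v * y := by
    rw [hu, hv]; linear_combination (-(a : ℤ)) * hcas
  have hpuv : p = u * y + v * (x + y) := by
    rw [hu, hv]; linear_combination (-p) * hcas
  have hauv' : (a : ℝ) = u * x + v * y := by exact_mod_cast hauv
  have hpuv' : (p : ℝ) = u * y + v * (x + y) := by exact_mod_cast hpuv
  have hs : (p : ℝ) - a * phi = ε * (u + v * ψ) := by
    rw [hauv', hpuv']; linear_combination u * e1 + v * e2
  have hw0 : 0 < u + v * ψ := by
    have : 0 < ε * (u + v * ψ) := by linarith
    exact pos_of_mul_pos_right this hpos.le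
  have hw1 : u + v * ψ ≤ 1 := by
    have : ε * (u + v * ψ) ≤ ε * 1 := by linarith
    exact le_of_mul_le_mul_left this hpos
  have hxz : (0 : ℤ) < x := by exact_mod_cast hx
  have hyz : (0 : ℤ) < y := by exact_mod_cast hy
  have haz : (1 : ℤ) ≤ a := by exact_mod_cast ha
  have hltz : (a : ℤ) < x + y := by exact_mod_cast hlt
  have hu0 : 0 < u := by
    by_contra! hu0
    have hu0' : (u : ℝ) ≤ 0 := by exact_mod_cast hu0
    have hv0 : v < 0 := by
      by_contra! hv0
      have : (0 : ℝ) ≤ v := by exact_mod_cast hv0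
      nlinarith
    nlinarith
  have hu1 : (1 : ℝ) ≤ u := by exact_mod_cast hu0
  have hv0 : 0 ≤ v := by
    by_contra! hv0
    have : (v : ℝ) < 0 := by exact_mod_cast hv0
    nlinarith
  have hv1 : v = 0 := by
    by_contra hv1
    have : 1 ≤ v := by omega
    nlinarith
  subst hv1
  have hu2 : u = 1 := by
    have : (u : ℝ) ≤ 1 := by simpa using hw1
    have : u ≤ 1 := by exact_mod_cast this
    omega
  rw [hu2] at hauv
  omega

lemma exists_fib_even_le_lt {n : ℕ} (hn : 1 ≤ n) :
    ∃ j : ℕ, Nat.fib (2 * j + 2) ≤ n ∧ n < Nat.fib (2 * j + 4) := by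
  have hex : ∃ j : ℕ, n < Nat.fib (2 * j + 4) :=
    ⟨n, by have := Nat.le_fib_add_one (2 * n + 4); omega⟩
  classical
  refine ⟨Nat.find hex, ?_, Nat.find_spec hex⟩
  rcases hj : Nat.find hex with _ | j
  · simpa using hn
  · exact not_lt.1 (Nat.find_min hex (m := j) (by omega))

/-- Theorem 3.5(iii): `L + U₀ = ℕ \ {F_k - 1 : k ≥ 2, k even}`. -/
theorem lower_add_upper0 (m : ℕ) :
    (¬∃ a ∈ lowerWythoff, ∃ b ∈ upperWythoff ∪ {0}, m = a + b) ↔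
      ∃ k : ℕ, 2 ≤ k ∧ Even k ∧ m + 1 = Nat.fib k := by
  rw [not_mem_lower_add_upper0_iff_record]
  constructor
  · intro hrec
    obtain ⟨j, hle, hlt⟩ := exists_fib_even_le_lt (Nat.succ_le_succ m.zero_le)
    refine ⟨2 * j + 2, by omega, ⟨j + 1, by ring⟩, ?_⟩
    by_contra hne
    have h := hrec (Nat.fib (2 * j + 2)) (Nat.fib_pos.2 (by omega)) (by omega)
    rw [fract_fib_even_mul_phi] at h
    exact hne (eq_fib_of_le_fract (by omega) hlt h.le)
  · rintro ⟨k, hk, ⟨l, rfl⟩, hm⟩ a ha ham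
    obtain ⟨j, rfl⟩ : ∃ j, l = j + 1 := ⟨l - 1, by omega⟩
    rw [show j + 1 + (j + 1) = 2 * j + 2 by ring] at hm
    by_contra! h
    rw [hm, fract_fib_even_mul_phi] at h
    have hmono : Nat.fib (2 * j + 2) ≤ Nat.fib (2 * j + 4) := Nat.fib_mono (by omega)
    have := eq_fib_of_le_fract ha (by omega) h
    omega
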